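/- If an unsatisfiable linear CNF formula φ has a configuration-style Res(⊕) refutation of space s (whose inference steps use the resolution and semantic weakening rules), then φ has a configuration-style refutation of space at most s + 1 whose inference steps use only the syntactic rules: resolution, simplification, syntactic weakening, and addition. -/

import Mathlib

open Finset

/-- The two-element field. -/
abbrev F2 : Type := ZMod 2

/-- An `F2`-linear form in the variables `V`, given by its coefficients. -/
abbrev LinForm (V : Type) : Type := V → F2

/-- A linear literal: an equation `f = a` where `f` is a linear form and `a ∈ F2`. -/
abbrev LinLit (V : Type) : Type := LinForm V × F2

/-- A linear clause: a finite disjunction of linear literals. -/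
abbrev LinClause (V : Type) : Type := Finset (LinLit V)

/-- A linear system: a finite conjunction of linear equations. -/
abbrev LinSystem (V : Type) : Type := Finset (LinLit V)

/-- A linear CNF formula: a conjunction of linear clauses. -/
abbrev LinCNF (V : Type) : Type := Set (LinClause V)

variable {V : Type}

/-- Evaluation of a linear form at an assignment. -/
def evalForm [Fintype V] (f : LinForm V) (σ : V → F2) : F2 := ∑ v, f v * σ v

/-- The assignment `σ` satisfies the linear equation `l.1 = l.2`. -/
def LitSat [Fintype V] (σ : V → F2) (l : LinLit V) : Prop := evalForm l.1 σ = l.2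

/-- The assignment `σ` satisfies the linear clause `C` (some literal of `C` holds). -/
def ClauseSat [Fintype V] (σ : V → F2) (C : LinClause V) : Prop := ∃ l ∈ C, LitSat σ l

/-- The assignment `σ` is a solution of the linear system `S` (all equations hold). -/
def SysSat [Fintype V] (σ : V → F2) (S : LinSystem V) : Prop := ∀ l ∈ S, LitSat σ l

/-- The assignment `σ` satisfies the linear CNF `φ`. -/
def CNFSat [Fintype V] (σ : V → F2) (φ : LinCNF V) : Prop := ∀ C ∈ φ, ClauseSat σ C

/-- The linear CNF `φ` is unsatisfiable. -/
def Unsat [Fintype V] (φ : LinCNF V) : Prop := ¬ ∃ σ, CNFSat σ φ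

/-- The positive literal `v = 1` for a single variable `v`. -/
def posLit [DecidableEq V] (v : V) : LinLit V := (Pi.single v 1, 1)

/-- The negative literal `v = 0` for a single variable `v`. -/
def negLit [DecidableEq V] (v : V) : LinLit V := (Pi.single v 1, 0)

/-- A solution is `F`-proper if it satisfies every clause of `F`. -/
def FProper [Fintype V] (F : Set (LinClause V)) (σ : V → F2) : Prop := ∀ C ∈ F, ClauseSat σ C

/-- `φ` is `m`-extensible w.r.t. `F`: every linear system with fewer than `m` equations
that has an `F`-proper solution has, for each clause `C ∈ φ \ F`, an `F`-proper solution
satisfying `C`. -/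
def Extensible [Fintype V] (φ : LinCNF V) (F : Set (LinClause V)) (m : ℕ) : Prop :=
  ∀ S : LinSystem V, S.card < m → (∃ σ, SysSat σ S ∧ FProper F σ) →
    ∀ C ∈ φ \ F, ∃ τ, SysSat τ S ∧ FProper F τ ∧ ClauseSat τ C

/-- A configuration: a finite set of linear clauses kept in memory. -/
abbrev Config (V : Type) : Type := Finset (LinClause V)

/-- Semantic inference: `C` follows from clauses in `S` by the resolution rule or the
semantic weakening rule. -/
def InferSem [Fintype V] [DecidableEq V] (S : Config V) (C : LinClause V) : Prop :=
  (∃ (f : LinForm V) (A B : LinClause V),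
      insert (f, (0 : F2)) A ∈ S ∧ insert (f, (1 : F2)) B ∈ S ∧ C = A ∪ B) ∨
  (∃ D ∈ S, ∀ σ, ClauseSat σ D → ClauseSat σ C)

/-- The identically zero linear form. -/
def zeroForm (V : Type) : LinForm V := fun _ => 0

/-- Syntactic inference: `C` follows from clauses in `S` by the resolution rule,
the simplification rule, the syntactic weakening rule, or the addition rule. -/
def InferSyn [Fintype V] [DecidableEq V] (S : Config V) (C : LinClause V) : Prop :=
  (∃ (f : LinForm V) (A B : LinClause V),
      insert (f, (0 : F2)) A ∈ S ∧ insert (f, (1 : F2)) B ∈ S ∧ C = A ∪ B) ∨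
  (insert ((zeroForm V, (1 : F2)) : LinLit V) C ∈ S) ∨
  (∃ (D : LinClause V) (f : LinForm V) (α : F2), D ∈ S ∧ C = insert (f, α) D) ∨
  (∃ (D : LinClause V) (f₁ f₂ : LinForm V) (α₁ α₂ : F2),
      insert (f₁, α₁) (insert (f₂, α₂) D) ∈ S ∧
      C = insert (f₁, α₁) (insert (f₁ + f₂, α₁ + α₂ + 1) D))

/-- One step of a configuration-style refutation: download a clause of `φ`,
erase a clause, or add a clause inferred (via `Inf`) from the current configuration. -/
inductive ConfigStep [Fintype V] [DecidableEq V] (φ : LinCNF V)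
    (Inf : Config V → LinClause V → Prop) : Config V → Config V → Prop
  | download {S : Config V} {C : LinClause V} (h : C ∈ φ) : ConfigStep φ Inf S (insert C S)
  | erase {S : Config V} {C : LinClause V} (h : C ∈ S) : ConfigStep φ Inf S (S.erase C)
  | infer {S : Config V} {C : LinClause V} (h : Inf S C) : ConfigStep φ Inf S (insert C S)

/-- A configuration-style Res(⊕) refutation of `φ` with inference rules `Inf`:
a sequence of configurations starting from the empty configuration, each obtained from
the previous one by a basic step, ending with a configuration containing the empty
clause. -/
def IsConfigRefutation [Fintype V] [DecidableEq V] (φ : LinCNF V)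
    (Inf : Config V → LinClause V → Prop) (π : List (Config V)) : Prop :=
  π.head? = some (∅ : Config V) ∧ List.Chain' (ConfigStep φ Inf) π ∧
    ∃ S : Config V, π.getLast? = some S ∧ (∅ : LinClause V) ∈ S

/-- The space of a sequence of configurations: the maximum number of clauses in memory. -/
def spaceOf (π : List (Config V)) : ℕ := (π.map Finset.card).foldr max 0

/-- The linear equation expressing that a literal fails, encoded as a vector of the space of
linear forms extended by the constants. The encoding is an involution. -/
def negVec (l : LinLit V) : LinLit V := (l.1, l.2 + 1)

/-- Every assignment satisfies the clause `C`. -/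
def IsTaut [Fintype V] (C : LinClause V) : Prop := ∀ σ, ClauseSat σ C

/-- One configuration step with syntactic inferences into a configuration of size at most `k`. -/
def BoundedStep [Fintype V] [DecidableEq V] (φ : LinCNF V) (k : ℕ) (S T : Config V) : Prop :=
  ConfigStep φ InferSyn S T ∧ T.card ≤ k

lemma F2.add_self (a : F2) : a + a = 0 := CharTwo.add_self_eq_zero a

lemma F2.eq_zero_or_one (a : F2) : a = 0 ∨ a = 1 := by
  revert a; decide

lemma F2.ne_iff (a b : F2) : a ≠ b ↔ a + (b + 1) = 0 := by
  revert a b; decide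

lemma negVec_negVec (l : LinLit V) : negVec (negVec l) = l := by
  ext <;> simp [negVec, add_assoc, F2.add_self]

lemma spaceOf_le_iff {π : List (Config V)} {k : ℕ} : spaceOf π ≤ k ↔ ∀ S ∈ π, S.card ≤ k := by
  induction π with
  | nil => simp [spaceOf]
  | cons S π ih =>
    rw [List.forall_mem_cons, ← ih]
    exact max_le_iff

section

variable [Fintype V]

/-- The linear functional on extended linear forms given by evaluation at `σ`. -/
def evalFun (σ : V → F2) (t : F2) : LinLit V →ₗ[F2] F2 where
  toFun u := evalForm u.1 σ + u.2 * t
  map_add' u v := by simp only [evalForm, Prod.fst_add, Prod.snd_add, Pi.add_apply, add_mul,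
    sum_add_distrib]; ring
  map_smul' a u := by simp [evalForm, mul_add, mul_sum, mul_assoc]

lemma evalFun_apply (σ : V → F2) (t : F2) (u : LinLit V) :
    evalFun σ t u = evalForm u.1 σ + u.2 * t := rfl

lemma not_litSat_iff (σ : V → F2) (l : LinLit V) :
    ¬ LitSat σ l ↔ evalFun σ 1 (negVec l) = 0 := by
  rw [evalFun_apply, mul_one]
  exact F2.ne_iff _ _

lemma evalFun_add (σ τ : V → F2) (s t : F2) (u : LinLit V) :
    evalFun (σ + τ) (s + t) u = evalFun σ s u + evalFun τ t u := by
  simp only [evalFun_apply, evalForm, Pi.add_apply, mul_add, sum_add_distrib]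
  ring

lemma exists_eq_evalFun [DecidableEq V] (g : LinLit V →ₗ[F2] F2) : ∃ σ t, g = evalFun σ t := by
  refine ⟨fun v => g (Pi.single v 1, 0), g (0, 1), ?_⟩
  ext v
  · simp [evalFun_apply, evalForm, Pi.single_apply]
  · simp [evalFun_apply, evalForm]

/-- A consistent linear system implies only equations in its span. -/
lemma negVec_mem_span [DecidableEq V] {C D : LinClause V} (hC : ¬ IsTaut C)
    (h : ∀ σ, ClauseSat σ D → ClauseSat σ C) {d : LinLit V} (hd : d ∈ D) :
    negVec d ∈ Submodule.span F2 (negVec '' (C : Set (LinLit V))) := by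
  have key : ∀ σ, (∀ c ∈ C, evalFun σ 1 (negVec c) = 0) → evalFun σ 1 (negVec d) = 0 := by
    intro σ hσ
    rw [← not_litSat_iff]
    intro hsat
    obtain ⟨c, hc, hcs⟩ := h σ ⟨d, hd, hsat⟩
    exact (not_litSat_iff σ c).2 (hσ c hc) hcs
  obtain ⟨σ₀, hσ₀⟩ := not_forall.1 hC
  have hσ₀C : ∀ c ∈ C, evalFun σ₀ 1 (negVec c) = 0 := fun c hc =>
    (not_litSat_iff σ₀ c).1 fun hs => hσ₀ ⟨c, hc, hs⟩
  by_contra hmem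
  obtain ⟨g, hgd, hg⟩ := Submodule.exists_le_ker_of_notMem hmem
  have hgC : ∀ c ∈ C, g (negVec c) = 0 := fun c hc =>
    hg (Submodule.subset_span ⟨c, hc, rfl⟩)
  obtain ⟨τ, t, rfl⟩ := exists_eq_evalFun g
  obtain rfl | rfl : t = 0 ∨ t = 1 := F2.eq_zero_or_one t
  · have := key (σ₀ + τ) fun c hc => by
      rw [← add_zero (1 : F2), evalFun_add, hσ₀C c hc, hgC c hc, add_zero]
    rw [← add_zero (1 : F2), evalFun_add, key σ₀ hσ₀C, zero_add] at this
    exact hgd this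
  · exact hgd (key τ hgC)

open Classical in
/-- The clauses of a configuration that are not tautologies. -/
noncomputable def nonTaut (S : Config V) : Config V := S.filter fun C => ¬ IsTaut C

lemma mem_nonTaut {S : Config V} {C : LinClause V} : C ∈ nonTaut S ↔ C ∈ S ∧ ¬ IsTaut C := by
  simp [nonTaut]

lemma card_nonTaut_le (S : Config V) : (nonTaut S).card ≤ S.card :=
  card_le_card fun _ hC => (mem_nonTaut.1 hC).1

lemma nonTaut_insert_of_isTaut {S : Config V} {C : LinClause V} (hC : IsTaut C) :
    nonTaut (insert C S) = nonTaut S := by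
  simp [nonTaut, filter_insert, hC]

lemma nonTaut_insert {S : Config V} {C : LinClause V} (hC : ¬ IsTaut C) :
    nonTaut (insert C S) = insert C (nonTaut S) := by
  simp [nonTaut, filter_insert, hC]

lemma clauseSat_insert {σ : V → F2} {l : LinLit V} {A : LinClause V} :
    ClauseSat σ (insert l A) ↔ LitSat σ l ∨ ClauseSat σ A := by
  simp [ClauseSat, or_and_right, exists_or]

lemma clauseSat_union {σ : V → F2} {A B : LinClause V} :
    ClauseSat σ (A ∪ B) ↔ ClauseSat σ A ∨ ClauseSat σ B := by
  simp [ClauseSat, or_and_right, exists_or]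

lemma not_litSat_both {σ : V → F2} {f : LinForm V} (h₀ : LitSat σ (f, 0))
    (h₁ : LitSat σ (f, 1)) : False :=
  zero_ne_one (α := F2) (h₀.symm.trans h₁)

lemma nonTaut_erase (S : Config V) (C : LinClause V) :
    nonTaut (S.erase C) = (nonTaut S).erase C := by
  ext; simp only [mem_nonTaut, mem_erase]; tauto

lemma clauseSat_resolvent {σ : V → F2} {f : LinForm V} {A B : LinClause V}
    (h₀ : ClauseSat σ (insert (f, 0) A)) (h₁ : ClauseSat σ (insert (f, 1) B)) :
    ClauseSat σ (A ∪ B) := by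
  rw [clauseSat_insert] at h₀ h₁
  rw [clauseSat_union]
  rcases h₀ with h₀ | h₀
  · exact h₁.imp (fun h => (not_litSat_both h₀ h).elim) id
  · exact Or.inl h₀

variable [DecidableEq V]

lemma InferSyn.mono {S T : Config V} (hST : S ⊆ T) {C : LinClause V} (h : InferSyn S C) :
    InferSyn T C := by
  rcases h with ⟨f, A, B, h₁, h₂, h₃⟩ | h | ⟨D, f, α, h₁, h₂⟩ | ⟨D, f₁, f₂, α₁, α₂, h₁, h₂⟩
  · exact Or.inl ⟨f, A, B, hST h₁, hST h₂, h₃⟩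
  · exact Or.inr (Or.inl (hST h))
  · exact Or.inr (Or.inr (Or.inl ⟨D, f, α, hST h₁, h₂⟩))
  · exact Or.inr (Or.inr (Or.inr ⟨D, f₁, f₂, α₁, α₂, hST h₁, h₂⟩))

/-- `D` derives `C` by a chain of inferences each of which uses only the previous clause. -/
def ChainDerives (D C : LinClause V) : Prop :=
  Relation.ReflTransGen (fun X Y : LinClause V => InferSyn {X} Y) D C

lemma chainDerives_union (D C : LinClause V) : ChainDerives D (C ∪ D) := by
  induction C using Finset.induction_on with
  | empty => rw [empty_union]; exact Relation.ReflTransGen.refl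
  | insert c C _ ih =>
    refine ih.tail (Or.inr (Or.inr (Or.inl ⟨C ∪ D, c.1, c.2, mem_singleton_self _, ?_⟩)))
    rw [insert_union]

lemma chainDerives_add {E : LinClause V} {v : LinLit V}
    (hv : v ∈ Submodule.span F2 (negVec '' (E : Set (LinLit V)))) :
    ∀ u, ChainDerives (insert (negVec (u + v)) E) (insert (negVec u) E) := by
  induction hv using Submodule.span_induction with
  | mem x hx =>
    obtain ⟨c, hc, rfl⟩ := hx
    intro u
    refine Relation.ReflTransGen.single (Or.inr (Or.inr (Or.inr
      ⟨E, c.1, (negVec (u + negVec c)).1, c.2, (negVec (u + negVec c)).2, ?_, ?_⟩)))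
    · simp only [Prod.mk.eta, mem_singleton]
      exact insert_eq_of_mem (mem_insert_of_mem hc)
    · have hadd : ((c.1 + (negVec (u + negVec c)).1, c.2 + (negVec (u + negVec c)).2 + 1) :
          LinLit V) = negVec u := by
        ext
        · simp only [negVec, Prod.fst_add, Pi.add_apply]
          linear_combination F2.add_self (c.1 _)
        · simp only [negVec, Prod.snd_add]
          linear_combination F2.add_self c.2 + F2.add_self 1
      rw [hadd, Prod.mk.eta]
      exact (insert_eq_of_mem (mem_insert_of_mem hc)).symm
  | zero => intro u; rw [add_zero]; exact Relation.ReflTransGen.refl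
  | add x y _ _ hx hy =>
    intro u
    rw [← add_assoc]
    exact (hy (u + x)).trans (hx u)
  | smul a x _ hx =>
    intro u
    obtain rfl | rfl : a = 0 ∨ a = 1 := F2.eq_zero_or_one a
    · rw [zero_smul, add_zero]; exact Relation.ReflTransGen.refl
    · rw [one_smul]; exact hx u

lemma chainDerives_erase_literal {E : LinClause V} {d : LinLit V}
    (hd : negVec d ∈ Submodule.span F2 (negVec '' (E : Set (LinLit V)))) :
    ChainDerives (insert d E) E := by
  have h := chainDerives_add hd 0
  rw [zero_add, negVec_negVec] at h
  refine h.tail (Or.inr (Or.inl ?_))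
  have h0 : negVec (0 : LinLit V) = (zeroForm V, 1) := by
    ext <;> simp [negVec, zeroForm]
  rw [h0]
  exact mem_singleton_self _

/-- Semantic weakening to a non-tautological clause is a chain of syntactic inferences. -/
lemma chainDerives_of_entails {C D : LinClause V} (hC : ¬ IsTaut C)
    (h : ∀ σ, ClauseSat σ D → ClauseSat σ C) : ChainDerives D C := by
  have hrem : ∀ X : LinClause V, X ⊆ D → ChainDerives (X ∪ C) C := by
    intro X
    induction X using Finset.induction_on with
    | empty => intro _; rw [empty_union]; exact Relation.ReflTransGen.refl
    | insert x X _ ih =>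
      intro hX
      rw [insert_subset_iff] at hX
      rw [insert_union]
      refine Relation.ReflTransGen.trans (chainDerives_erase_literal ?_) (ih hX.2)
      refine Submodule.span_mono (Set.image_mono ?_) (negVec_mem_span hC h hX.1)
      exact_mod_cast subset_union_right
  refine (chainDerives_union D C).trans ?_
  rw [union_comm]
  exact hrem D Subset.rfl

/-- A chain of inferences from a clause in memory needs room for two more clauses. -/
lemma reach_of_chainDerives (φ : LinCNF V) {k : ℕ} {S : Config V} (hk : S.card + 2 ≤ k)
    {D C : LinClause V} (hD : D ∈ S) (h : ChainDerives D C) :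
    Relation.ReflTransGen (BoundedStep φ k) S (insert C S) := by
  induction h with
  | refl => rw [insert_eq_of_mem hD]
  | @tail X Y _ hXY ih =>
    have hX : (insert X S).card ≤ S.card + 1 := card_insert_le _ _
    have hY : (insert Y (insert X S)).card ≤ (insert X S).card + 1 := card_insert_le _ _
    have h₁ : Relation.ReflTransGen (BoundedStep φ k) S (insert Y (insert X S)) :=
      ih.tail ⟨.infer (hXY.mono (by simp)), by omega⟩
    by_cases hXS : X ∈ S
    · rwa [insert_eq_of_mem hXS] at h₁
    by_cases hne : X = Y
    · subst hne; exact ih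
    have herase : (insert Y (insert X S)).erase X = insert Y S := by
      rw [erase_insert_of_ne (Ne.symm hne), erase_insert hXS]
    have hcard : (insert Y S).card ≤ S.card + 1 := card_insert_le _ _
    refine h₁.tail ⟨?_, by omega⟩
    rw [← herase]
    exact .erase (mem_insert_of_mem (mem_insert_self _ _))

/-- A non-tautological clause inferred semantically follows from the non-tautological clauses in
memory, by resolution or by semantic weakening of a single clause. -/
lemma inferSem_nonTaut {S : Config V} {C : LinClause V} (h : InferSem S C) (hC : ¬ IsTaut C) :
    InferSem (nonTaut S) C := by
  rcases h with ⟨f, A, B, h₀, h₁, rfl⟩ | ⟨D, hD, hDC⟩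
  · by_cases t₀ : IsTaut (insert (f, 0) A)
    · refine Or.inr ⟨_, mem_nonTaut.2 ⟨h₁, fun t₁ => hC fun σ => ?_⟩, fun σ hσ => ?_⟩
      · exact clauseSat_resolvent (t₀ σ) (t₁ σ)
      · exact clauseSat_resolvent (t₀ σ) hσ
    by_cases t₁ : IsTaut (insert (f, 1) B)
    · exact Or.inr ⟨_, mem_nonTaut.2 ⟨h₀, t₀⟩, fun σ hσ => clauseSat_resolvent hσ (t₁ σ)⟩
    · exact Or.inl ⟨f, A, B, mem_nonTaut.2 ⟨h₀, t₀⟩, mem_nonTaut.2 ⟨h₁, t₁⟩, rfl⟩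
  · exact Or.inr ⟨D, mem_nonTaut.2 ⟨hD, fun t => hC fun σ => hDC σ (t σ)⟩, hDC⟩

/-- A semantic step is simulated, on the non-tautological clauses, by syntactic steps using one
additional clause of memory. -/
lemma reach_nonTaut_of_step {φ : LinCNF V} {s : ℕ} {S T : Config V}
    (h : ConfigStep φ InferSem S T) (hT : T.card ≤ s) :
    Relation.ReflTransGen (BoundedStep φ (s + 1)) (nonTaut S) (nonTaut T) := by
  have hT' := card_nonTaut_le T
  cases h with
  | @download C hC =>
    by_cases t : IsTaut C
    · rw [nonTaut_insert_of_isTaut t]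
    · rw [nonTaut_insert t] at hT' ⊢
      exact .single ⟨.download hC, by omega⟩
  | @erase C hC =>
    rw [nonTaut_erase] at hT' ⊢
    by_cases hmem : C ∈ nonTaut S
    · exact .single ⟨.erase hmem, by omega⟩
    · rw [erase_eq_of_notMem hmem]
  | @infer C hC =>
    by_cases t : IsTaut C
    · rw [nonTaut_insert_of_isTaut t]
    rw [nonTaut_insert t] at hT' ⊢
    by_cases hmem : C ∈ nonTaut S
    · rw [insert_eq_of_mem hmem]
    rcases inferSem_nonTaut hC t with hres | ⟨D, hD, hDC⟩
    · exact .single ⟨.infer (Or.inl hres), by omega⟩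
    · rw [card_insert_of_notMem hmem] at hT'
      exact reach_of_chainDerives φ (by omega) hD (chainDerives_of_entails t hDC)

lemma reach_nonTaut_of_chain {φ : LinCNF V} {s : ℕ} {T : Config V} (π : List (Config V)) :
    ∀ S, List.IsChain (ConfigStep φ InferSem) (S :: π) → (S :: π).getLast? = some T →
      (∀ U ∈ S :: π, U.card ≤ s) →
      Relation.ReflTransGen (BoundedStep φ (s + 1)) (nonTaut S) (nonTaut T) := by
  induction π with
  | nil =>
    intro S _ hlast _
    obtain rfl : S = T := by simpa using hlast
    exact .refl
  | cons U π ih =>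
    intro S hchain hlast hcard
    rw [List.isChain_cons_cons] at hchain
    rw [List.getLast?_cons_cons] at hlast
    refine (reach_nonTaut_of_step hchain.1 (hcard U (by simp))).trans
      (ih U hchain.2 hlast fun W hW => hcard W (List.mem_cons_of_mem _ hW))

lemma exists_chain_of_reach {φ : LinCNF V} {k : ℕ} {S T : Config V}
    (h : Relation.ReflTransGen (BoundedStep φ k) S T) (hS : S.card ≤ k) :
    ∃ π : List (Config V), List.IsChain (ConfigStep φ InferSyn) (S :: π) ∧
      (S :: π).getLast? = some T ∧ ∀ U ∈ S :: π, U.card ≤ k := by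
  induction h using Relation.ReflTransGen.head_induction_on with
  | refl => exact ⟨[], by simp, by simp, by simpa using hS⟩
  | @head A B hAB _ ih =>
    obtain ⟨π, h₁, h₂, h₃⟩ := ih hAB.2
    refine ⟨B :: π, List.isChain_cons_cons.2 ⟨hAB.1, h₁⟩, ?_, ?_⟩
    · rwa [List.getLast?_cons_cons]
    · exact List.forall_mem_cons.2 ⟨hS, h₃⟩

end

/-- If an unsatisfiable linear CNF `φ` has a configuration-style Res(⊕)
refutation of space `s` (with the resolution and semantic weakening rules), then it has a
configuration-style refutation of space at most `s + 1` using only the syntactic rules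
(resolution, simplification, syntactic weakening, addition). -/
theorem syntactic_refutation_of_semantic_refutation
    {V : Type} [Fintype V] [DecidableEq V] (φ : LinCNF V) (hunsat : Unsat φ) (s : ℕ)
    (h : ∃ π : List (Config V), IsConfigRefutation φ InferSem π ∧ spaceOf π = s) :
    ∃ π' : List (Config V), IsConfigRefutation φ InferSyn π' ∧ spaceOf π' ≤ s + 1 := by
  obtain ⟨π, ⟨hhead, hchain, T, hlast, hT⟩, hs⟩ := h
  obtain ⟨π, rfl⟩ : ∃ ρ, π = ∅ :: ρ := by
    cases π with
    | nil => simp at hhead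
    | cons S ρ => exact ⟨ρ, by simpa using hhead⟩
  have hreach := reach_nonTaut_of_chain π ∅ hchain hlast (spaceOf_le_iff.1 hs.le)
  obtain ⟨ρ, hρ, hρlast, hρcard⟩ := exists_chain_of_reach hreach (by simp [nonTaut])
  refine ⟨_, ⟨by simp [nonTaut], hρ, _, hρlast, mem_nonTaut.2 ⟨hT, fun t => ?_⟩⟩,
    spaceOf_le_iff.2 hρcard⟩
  obtain ⟨l, hl, _⟩ := t 0
  exact notMem_empty l hl
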